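/- Suppose v ∈ W^{1,6}(Ω) ∩ H²(Ω) on the periodic box Ω = (0,1)²×(−h,h) satisfies sup_{r≥2} ‖v‖_{L^r(Ω)}/√r ≤ K for some K ≥ 1. Then there is a constant C (depending on K, h) such that ‖v‖_{L^∞(Ω)}² ≤ C · log( C‖v‖_{H²(Ω)}² + e ). -/

import Mathlib

open MeasureTheory Real Set

noncomputable section

def Omg (h : ℝ) : Set (ℝ × ℝ × ℝ) := Set.Ioo 0 1 ×ˢ Set.Ioo 0 1 ×ˢ Set.Ioo (-h) h

/-- The `L^r(Ω)` norm. -/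
def Lnorm (h r : ℝ) (f : ℝ × ℝ × ℝ → ℝ) : ℝ := (∫ p in Omg h, |f p| ^ r) ^ (1 / r)

/-- The squared `H²(Ω)` norm. -/
def H2sq (h : ℝ) (f : ℝ × ℝ × ℝ → ℝ) : ℝ :=
  ∫ p in Omg h, ((f p) ^ 2 + ‖fderiv ℝ f p‖ ^ 2 + ‖fderiv ℝ (fderiv ℝ f) p‖ ^ 2)

theorem setIntegral_Ioc_box {F : ℝ × ℝ × ℝ → ℝ} (hF : Continuous F) {a a' b b' c c' : ℝ}
    (ha : a ≤ a') (hb : b ≤ b') (hc : c ≤ c') :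
    ∫ p in Ioc a a' ×ˢ Ioc b b' ×ˢ Ioc c c', F p
      = ∫ x in a..a', ∫ y in b..b', ∫ z in c..c', F (x, y, z) := by
  rw [intervalIntegral.integral_of_le ha, Measure.volume_eq_prod, setIntegral_prod]
  · refine setIntegral_congr_fun measurableSet_Ioc fun x _ => ?_
    rw [intervalIntegral.integral_of_le hb, Measure.volume_eq_prod, setIntegral_prod]
    · refine setIntegral_congr_fun measurableSet_Ioc fun y _ => ?_
      rw [intervalIntegral.integral_of_le hc]
    · exact ((hF.comp (Continuous.prodMk_right x)).continuousOn.integrableOn_compact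
        (isCompact_Icc.prod isCompact_Icc)).mono_set
        (prod_mono Ioc_subset_Icc_self Ioc_subset_Icc_self)
  · exact (hF.continuousOn.integrableOn_compact
        (isCompact_Icc.prod (isCompact_Icc.prod isCompact_Icc))).mono_set
        (prod_mono Ioc_subset_Icc_self (prod_mono Ioc_subset_Icc_self Ioc_subset_Icc_self))

theorem Omg_ae_eq_Ioc (h : ℝ) :
    Omg h =ᵐ[volume] Ioc (0 : ℝ) 1 ×ˢ Ioc (0 : ℝ) 1 ×ˢ Ioc (-h) h := by
  rw [Measure.volume_eq_prod, Measure.volume_eq_prod]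
  exact Measure.set_prod_ae_eq Ioo_ae_eq_Ioc (Measure.set_prod_ae_eq Ioo_ae_eq_Ioc Ioo_ae_eq_Ioc)

/-- The integral of a continuous function over a period box does not depend on the box. -/
theorem setIntegral_period_box {h : ℝ} (hh : 0 < h) {F : ℝ × ℝ × ℝ → ℝ} (hF : Continuous F)
    (h1 : ∀ x y z, F (x + 1, y, z) = F (x, y, z)) (h2 : ∀ x y z, F (x, y + 1, z) = F (x, y, z))
    (h3 : ∀ x y z, F (x, y, z + 2 * h) = F (x, y, z)) (a b c : ℝ) :
    ∫ p in Ioc a (a + 1) ×ˢ Ioc b (b + 1) ×ˢ Ioc c (c + 2 * h), F p = ∫ p in Omg h, F p := by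
  rw [setIntegral_congr_set (Omg_ae_eq_Ioc h), setIntegral_Ioc_box hF (by linarith) (by linarith)
    (by linarith), setIntegral_Ioc_box hF zero_le_one zero_le_one (by linarith)]
  have e3 : ∀ x y, ∫ z in c..c + 2 * h, F (x, y, z) = ∫ z in -h..h, F (x, y, z) := fun x y => by
    have := Function.Periodic.intervalIntegral_add_eq (f := fun z => F (x, y, z)) (T := 2 * h)
      (fun z => h3 x y z) c (-h)
    rwa [show -h + 2 * h = h by ring] at this
  have e2 : ∀ x, ∫ y in b..b + 1, ∫ z in -h..h, F (x, y, z)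
      = ∫ y in (0 : ℝ)..1, ∫ z in -h..h, F (x, y, z) := fun x => by
    have := Function.Periodic.intervalIntegral_add_eq
      (f := fun y => ∫ z in -h..h, F (x, y, z)) (T := 1) (fun y => by simp only [h2]) b 0
    rwa [zero_add] at this
  have e1 := Function.Periodic.intervalIntegral_add_eq
      (f := fun x => ∫ y in (0 : ℝ)..1, ∫ z in -h..h, F (x, y, z)) (T := 1)
      (fun x => by simp only [h1]) a 0
  rw [zero_add] at e1
  simp only [e3, e2, e1]

instance : (volume : Measure (ℝ × ℝ × ℝ)).IsAddHaarMeasure :=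
  Measure.prod.instIsAddHaarMeasure _ _

theorem setIntegral_comp_const_add_ball (F : ℝ × ℝ × ℝ → ℝ) (x₀ : ℝ × ℝ × ℝ) (R : ℝ) :
    ∫ y in Metric.ball 0 R, F (x₀ + y) = ∫ p in Metric.ball x₀ R, F p := by
  have := (measurePreserving_add_left (volume : Measure (ℝ × ℝ × ℝ)) x₀).setIntegral_preimage_emb
    (MeasurableEquiv.addLeft x₀).measurableEmbedding F (Metric.ball x₀ R)
  rw [← this]
  congr 2
  ext y
  simp [dist_eq_norm]

/-- Over a ball fitting into a period box, a nonnegative periodic function has at most the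
integral over the period box. -/
theorem setIntegral_ball_le_Omg {h : ℝ} (hh : 0 < h) {F : ℝ × ℝ × ℝ → ℝ} (hF : Continuous F)
    (h0 : ∀ p, 0 ≤ F p)
    (h1 : ∀ x y z, F (x + 1, y, z) = F (x, y, z)) (h2 : ∀ x y z, F (x, y + 1, z) = F (x, y, z))
    (h3 : ∀ x y z, F (x, y, z + 2 * h) = F (x, y, z)) (x₀ : ℝ × ℝ × ℝ) {R : ℝ}
    (hR : R ≤ 1 / 2) (hRh : R ≤ h) :
    ∫ y in Metric.ball 0 R, F (x₀ + y) ≤ ∫ p in Omg h, F p := by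
  rw [setIntegral_comp_const_add_ball,
    ← setIntegral_period_box hh hF h1 h2 h3 (x₀.1 - 1 / 2) (x₀.2.1 - 1 / 2) (x₀.2.2 - h)]
  refine setIntegral_mono_set ?_ (Filter.Eventually.of_forall h0) (LE.le.eventuallyLE ?_)
  · exact (hF.continuousOn.integrableOn_compact
        (isCompact_Icc.prod (isCompact_Icc.prod isCompact_Icc))).mono_set
        (prod_mono Ioc_subset_Icc_self (prod_mono Ioc_subset_Icc_self Ioc_subset_Icc_self))
  · intro p hp
    obtain ⟨x, y, z⟩ := p
    obtain ⟨a, b, c⟩ := x₀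
    simp only [Metric.mem_ball, Prod.dist_eq, Real.dist_eq, sup_lt_iff, abs_lt] at hp
    obtain ⟨⟨_, _⟩, ⟨_, _⟩, ⟨_, _⟩⟩ := hp
    simp only [mem_prod, mem_Ioc]
    refine ⟨⟨?_, ?_⟩, ⟨?_, ?_⟩, ⟨?_, ?_⟩⟩ <;> linarith

theorem volume_real_ball_prod {ρ : ℝ} (hρ : 0 ≤ ρ) (x : ℝ × ℝ × ℝ) :
    (volume : Measure (ℝ × ℝ × ℝ)).real (Metric.ball x ρ) = 8 * ρ ^ 3 := by
  obtain ⟨a, b, c⟩ := x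
  rw [measureReal_def, ← ball_prod_same, ← ball_prod_same, Measure.volume_eq_prod,
    Measure.prod_prod, Measure.volume_eq_prod, Measure.prod_prod]
  simp only [Real.volume_ball, ENNReal.toReal_mul]
  rw [ENNReal.toReal_ofReal (by linarith)]
  ring

theorem setIntegral_ball_comp_smul (F : ℝ × ℝ × ℝ → ℝ) {s : ℝ} (hs : 0 < s) (ρ : ℝ) :
    ∫ y in Metric.ball 0 ρ, F (s • y) = (s ^ 3)⁻¹ * ∫ y in Metric.ball 0 (s * ρ), F y := by
  rw [Measure.setIntegral_comp_smul_of_pos _ _ _ hs, smul_ball hs.ne', smul_zero,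
    Real.norm_of_nonneg hs.le]
  simp

theorem abs_second_difference_le {g g' g'' : ℝ → ℝ} (hg : ∀ s, HasDerivAt g (g' s) s)
    (hg' : ∀ s, HasDerivAt g' (g'' s) s) (hc : Continuous g'') :
    |g 0 - 2 * g 1 + g 2| ≤ ∫ s in (0 : ℝ)..2, s * |g'' s| := by
  have e1 : ∫ s in (0 : ℝ)..1, s * g'' s = (1 * g' 1 - g 1) - (0 * g' 0 - g 0) := by
    refine intervalIntegral.integral_eq_sub_of_hasDerivAt (f := fun s => s * g' s - g s)
      (fun s _ => ?_) (Continuous.intervalIntegrable (by fun_prop) _ _)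
    exact (((hasDerivAt_id' s).mul (hg' s)).sub (hg s)).congr_deriv (by ring)
  have e2 : ∫ s in (1 : ℝ)..2, (2 - s) * g'' s
      = ((2 - 2) * g' 2 + g 2) - ((2 - 1) * g' 1 + g 1) := by
    refine intervalIntegral.integral_eq_sub_of_hasDerivAt (f := fun s => (2 - s) * g' s + g s)
      (fun s _ => ?_) (Continuous.intervalIntegrable (by fun_prop) _ _)
    exact ((((hasDerivAt_id' s).const_sub 2).mul (hg' s)).add (hg s)).congr_deriv (by ring)
  have b1 : |∫ s in (0 : ℝ)..1, s * g'' s| ≤ ∫ s in (0 : ℝ)..1, s * |g'' s| := by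
    refine (intervalIntegral.abs_integral_le_integral_abs zero_le_one).trans ?_
    refine intervalIntegral.integral_mono_on zero_le_one
      (Continuous.intervalIntegrable (by fun_prop) _ _)
      (Continuous.intervalIntegrable (by fun_prop) _ _) fun s hs => ?_
    rw [abs_mul, abs_of_nonneg hs.1]
  have b2 : |∫ s in (1 : ℝ)..2, (2 - s) * g'' s| ≤ ∫ s in (1 : ℝ)..2, s * |g'' s| := by
    refine (intervalIntegral.abs_integral_le_integral_abs one_le_two).trans ?_
    refine intervalIntegral.integral_mono_on one_le_two
      (Continuous.intervalIntegrable (by fun_prop) _ _)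
      (Continuous.intervalIntegrable (by fun_prop) _ _) fun s hs => ?_
    rw [abs_mul]
    refine mul_le_mul_of_nonneg_right ?_ (abs_nonneg _)
    rw [abs_le]
    constructor <;> linarith [hs.1, hs.2]
  rw [← intervalIntegral.integral_add_adjacent_intervals (a := 0) (b := 1) (c := 2)
    (Continuous.intervalIntegrable (by fun_prop) _ _)
    (Continuous.intervalIntegrable (by fun_prop) _ _)]
  calc |g 0 - 2 * g 1 + g 2|
      = |(∫ s in (0 : ℝ)..1, s * g'' s) + ∫ s in (1 : ℝ)..2, (2 - s) * g'' s| := by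
        rw [e1, e2]; congr 1; ring
    _ ≤ _ := (abs_add_le _ _).trans (add_le_add b1 b2)

theorem continuous_norm_fderiv_fderiv {E : Type*} [NormedAddCommGroup E] [NormedSpace ℝ E]
    {v : E → ℝ} (hv : ContDiff ℝ 2 v) : Continuous fun p => ‖fderiv ℝ (fderiv ℝ v) p‖ :=
  have hv1 : ContDiff ℝ 1 (fderiv ℝ v) := hv.fderiv_right (by norm_num)
  (hv1.continuous_fderiv (by norm_num)).norm

theorem abs_le_of_second_difference {E : Type*} [NormedAddCommGroup E] [NormedSpace ℝ E]
    {v : E → ℝ} (hv : ContDiff ℝ 2 v) {G : E → ℝ} (hG : Continuous G)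
    (hGv : ∀ p, ‖fderiv ℝ (fderiv ℝ v) p‖ ≤ G p) (x₀ y : E) :
    |v x₀| ≤ 2 * |v (x₀ + y)| + |v (x₀ + (2 : ℝ) • y)|
      + ‖y‖ ^ 2 * ∫ s in (0 : ℝ)..2, s * G (x₀ + s • y) := by
  have hv1 : ContDiff ℝ 1 (fderiv ℝ v) := hv.fderiv_right (by norm_num)
  have hv2 : Continuous (fderiv ℝ (fderiv ℝ v)) := hv1.continuous_fderiv (by norm_num)
  have hl : ∀ s : ℝ, HasDerivAt (fun s : ℝ => x₀ + s • y) y s := fun s => by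
    simpa using ((hasDerivAt_id s).smul_const y).const_add x₀
  have hg : ∀ s : ℝ, HasDerivAt (fun s : ℝ => v (x₀ + s • y)) (fderiv ℝ v (x₀ + s • y) y) s :=
    fun s => ((hv.differentiable (by norm_num)) _).hasFDerivAt.comp_hasDerivAt s (hl s)
  have hg' : ∀ s : ℝ, HasDerivAt (fun s : ℝ => fderiv ℝ v (x₀ + s • y) y)
      (fderiv ℝ (fderiv ℝ v) (x₀ + s • y) y y) s := fun s => by
    have := ((hv1.differentiable (by norm_num)) _).hasFDerivAt.comp_hasDerivAt s (hl s)
    simpa using this.clm_apply (hasDerivAt_const s y)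
  have key := abs_second_difference_le hg hg' (by fun_prop)
  simp only [zero_smul, add_zero, one_smul] at key
  have b : ∫ s in (0 : ℝ)..2, s * |fderiv ℝ (fderiv ℝ v) (x₀ + s • y) y y|
      ≤ ‖y‖ ^ 2 * ∫ s in (0 : ℝ)..2, s * G (x₀ + s • y) := by
    rw [← intervalIntegral.integral_const_mul]
    refine intervalIntegral.integral_mono_on zero_le_two
      (Continuous.intervalIntegrable (by fun_prop) _ _)
      (Continuous.intervalIntegrable (by fun_prop) _ _) fun s hs => ?_
    have := (fderiv ℝ (fderiv ℝ v) (x₀ + s • y)).le_opNorm₂ y y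
    rw [Real.norm_eq_abs] at this
    have := this.trans (mul_le_mul_of_nonneg_right (mul_le_mul_of_nonneg_right
      (hGv (x₀ + s • y)) (norm_nonneg y)) (norm_nonneg y))
    nlinarith [mul_le_mul_of_nonneg_left this hs.1]
  have t : |v x₀| ≤ |v x₀ - 2 * v (x₀ + y) + v (x₀ + (2 : ℝ) • y)| + 2 * |v (x₀ + y)|
      + |v (x₀ + (2 : ℝ) • y)| := by
    calc |v x₀| = |(v x₀ - 2 * v (x₀ + y) + v (x₀ + (2 : ℝ) • y)) + 2 * v (x₀ + y)
          + -v (x₀ + (2 : ℝ) • y)| := by congr 1; ring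
      _ ≤ _ := (abs_add_three _ _ _).trans (by rw [abs_neg, abs_mul, abs_two])
  linarith

theorem integrableOn_ball {F : ℝ × ℝ × ℝ → ℝ} (hF : Continuous F) (x : ℝ × ℝ × ℝ) (ρ : ℝ) :
    IntegrableOn F (Metric.ball x ρ) :=
  (hF.continuousOn.integrableOn_compact (isCompact_closedBall x ρ)).mono_set
    Metric.ball_subset_closedBall

/-- Bound of the averaged second-order remainder by the `L²` norm of `G`. -/
theorem setIntegral_ball_remainder_le {G : ℝ × ℝ × ℝ → ℝ} (hG : Continuous G)
    {ρ μ S : ℝ} (hρ : 0 < ρ) (hμ : 0 < μ)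
    (hS : ∀ R ≤ 2 * ρ, ∫ y in Metric.ball 0 R, G y ^ 2 ≤ S) :
    ∫ y in Metric.ball 0 ρ, ∫ s in (0 : ℝ)..2, s * G (s • y)
      ≤ (4 * ρ ^ 3 * μ + S / (2 * μ)) * (2 * √2) := by
  have hint : Integrable (Function.uncurry fun (y : ℝ × ℝ × ℝ) (s : ℝ) => s * G (s • y))
      ((volume.restrict (Metric.ball 0 ρ)).prod (volume.restrict (Ioc 0 2))) := by
    rw [Measure.prod_restrict]
    refine IntegrableOn.mono_set (ContinuousOn.integrableOn_compact
      ((isCompact_closedBall (0 : ℝ × ℝ × ℝ) ρ).prod (isCompact_Icc (a := (0 : ℝ)) (b := 2)))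
      ?_) (prod_mono Metric.ball_subset_closedBall Ioc_subset_Icc_self)
    unfold Function.uncurry
    fun_prop
  simp only [intervalIntegral.integral_of_le (zero_le_two : (0 : ℝ) ≤ 2)]
  rw [integral_integral_swap hint]
  have hI : ∫ s in Ioc (0 : ℝ) 2, s ^ (-(1 / 2) : ℝ) = 2 * √2 := by
    rw [← intervalIntegral.integral_of_le zero_le_two, integral_rpow (Or.inl (by norm_num)),
      Real.sqrt_eq_rpow]
    norm_num
    ring
  have hi : IntegrableOn (fun s : ℝ => s ^ (-(1 / 2) : ℝ)) (Ioc 0 2) :=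
    (intervalIntegrable_iff_integrableOn_Ioc_of_le zero_le_two).1
      (intervalIntegral.intervalIntegrable_rpow' (by norm_num))
  rw [← hI, ← integral_const_mul]
  refine setIntegral_mono_on hint.integral_prod_right (hi.const_mul _) measurableSet_Ioc
    fun s hs => ?_
  have hs0 : 0 < s := hs.1
  rw [integral_const_mul]
  set w : ℝ := s ^ (-(1 / 2) : ℝ) with hw
  have hw0 : 0 < w := rpow_pos_of_pos hs0 _
  have hw2 : w ^ 2 * s = 1 := by
    rw [hw, ← rpow_natCast, ← rpow_mul hs0.le]
    norm_num
    rw [rpow_neg_one]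
    field_simp
  have hsw : s = (w ^ 2)⁻¹ := by field_simp; linarith
  have hsq : ∫ y in Metric.ball 0 ρ, G (s • y) ^ 2 ≤ (s ^ 3)⁻¹ * S := by
    rw [setIntegral_ball_comp_smul (fun y => G y ^ 2) hs0]
    exact mul_le_mul_of_nonneg_left (hS _ (mul_le_mul_of_nonneg_right hs.2 hρ.le)) (by positivity)
  have hle : ∫ y in Metric.ball 0 ρ, G (s • y)
      ≤ ∫ y in Metric.ball 0 ρ, (μ * w ^ 3 / 2 + (2 * (μ * w ^ 3))⁻¹ * G (s • y) ^ 2) := by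
    refine setIntegral_mono_on (integrableOn_ball (by fun_prop) _ _)
      (integrableOn_ball (by fun_prop) _ _) measurableSet_ball fun y _ => ?_
    have : 0 < μ * w ^ 3 := by positivity
    have := sq_nonneg (G (s • y) - μ * w ^ 3)
    field_simp
    nlinarith
  rw [integral_add (integrableOn_ball (by fun_prop) _ _) (integrableOn_ball (by fun_prop) _ _),
    setIntegral_const, volume_real_ball_prod hρ.le, integral_const_mul, smul_eq_mul] at hle
  have h2 := hle.trans (add_le_add_right (mul_le_mul_of_nonneg_left hsq
    (by positivity : 0 ≤ (2 * (μ * w ^ 3))⁻¹)) _)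
  refine (mul_le_mul_of_nonneg_left h2 hs0.le).trans (le_of_eq ?_)
  rw [hsw]
  field_simp
  ring

theorem abs_mul_volume_le {v : ℝ × ℝ × ℝ → ℝ} (hv : ContDiff ℝ 2 v)
    {G : ℝ × ℝ × ℝ → ℝ} (hG : Continuous G) (hGv : ∀ p, ‖fderiv ℝ (fderiv ℝ v) p‖ ≤ G p)
    (x₀ : ℝ × ℝ × ℝ) {ρ μ S : ℝ} (hρ : 0 < ρ) (hμ : 0 < μ)
    (hS : ∀ R ≤ 2 * ρ, ∫ y in Metric.ball 0 R, G (x₀ + y) ^ 2 ≤ S) :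
    8 * ρ ^ 3 * |v x₀| ≤ 2 * (∫ y in Metric.ball 0 ρ, |v (x₀ + y)|)
      + (1 / 8) * (∫ y in Metric.ball 0 (2 * ρ), |v (x₀ + y)|)
      + ρ ^ 2 * ((4 * ρ ^ 3 * μ + S / (2 * μ)) * (2 * √2)) := by
  have hv0 : Continuous v := hv.continuous
  have hc : Continuous fun y : ℝ × ℝ × ℝ =>
      ∫ s in (0 : ℝ)..2, s * G (x₀ + s • y) :=
    intervalIntegral.continuous_parametric_intervalIntegral_of_continuous' (by fun_prop) _ _
  have hrem := setIntegral_ball_remainder_le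
    (G := fun y => G (x₀ + y)) (by fun_prop) hρ hμ hS
  have hscale := setIntegral_ball_comp_smul (fun y => |v (x₀ + y)|) two_pos ρ
  have hle : ∫ y in Metric.ball (0 : ℝ × ℝ × ℝ) ρ, |v x₀| ≤ ∫ y in Metric.ball 0 ρ,
      (2 * |v (x₀ + y)| + |v (x₀ + (2 : ℝ) • y)|
        + ρ ^ 2 * ∫ s in (0 : ℝ)..2, s * G (x₀ + s • y)) := by
    refine setIntegral_mono_on (integrableOn_ball (by fun_prop) _ _)
      (integrableOn_ball (by fun_prop) _ _) measurableSet_ball fun y hy => ?_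
    refine (abs_le_of_second_difference hv hG hGv x₀ y).trans (add_le_add_right ?_ _)
    have hy' : ‖y‖ ≤ ρ := by simpa using (mem_ball_zero_iff.1 hy).le
    refine mul_le_mul_of_nonneg_right (by gcongr)
      (intervalIntegral.integral_nonneg zero_le_two fun s hs => mul_nonneg hs.1 ((ContinuousLinearMap.opNorm_nonneg _).trans (hGv _)))
  rw [setIntegral_const, volume_real_ball_prod hρ.le, smul_eq_mul,
    integral_add (integrableOn_ball (by fun_prop) _ _) (integrableOn_ball (by fun_prop) _ _),
    integral_add (integrableOn_ball (by fun_prop) _ _) (integrableOn_ball (by fun_prop) _ _),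
    integral_const_mul, integral_const_mul, hscale] at hle
  have := mul_le_mul_of_nonneg_left hrem (sq_nonneg ρ)
  norm_num at hle ⊢
  linarith

/-- An `L¹` bound on a ball from an `L^r` bound. -/
theorem setIntegral_ball_abs_le {f : ℝ × ℝ × ℝ → ℝ} (hf : Continuous f) {R r A : ℝ} (hR : 0 ≤ R)
    (hr : 1 ≤ r) (hA : 0 < A)
    (hL : ∫ y in Metric.ball 0 R, |f y| ^ r ≤ (A * Real.exp (-1)) ^ r) :
    ∫ y in Metric.ball 0 R, |f y| ≤ A * (8 * R ^ 3 + Real.exp (-r)) := by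
  have hr0 : 0 ≤ r := by linarith
  have hcr : Continuous fun y => |f y| ^ r := hf.abs.rpow_const fun _ => Or.inr hr0
  have hpt : ∀ y, |f y| ≤ A + A / A ^ r * |f y| ^ r := fun y => by
    have hAr := rpow_pos_of_pos hA r
    rcases le_total (|f y|) A with hle | hle
    · have : 0 ≤ A / A ^ r * |f y| ^ r := by positivity
      linarith
    · have h1 : 1 ≤ |f y| / A := (one_le_div hA).2 hle
      have h2 : |f y| / A ≤ (|f y| / A) ^ r := by
        simpa using rpow_le_rpow_of_exponent_le h1 hr
      rw [div_rpow (abs_nonneg _) hA.le, div_le_iff₀ hA] at h2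
      calc |f y| ≤ |f y| ^ r / A ^ r * A := h2
        _ = A / A ^ r * |f y| ^ r := by ring
        _ ≤ _ := by linarith
  have hle : ∫ y in Metric.ball 0 R, |f y|
      ≤ ∫ y in Metric.ball 0 R, (A + A / A ^ r * |f y| ^ r) :=
    setIntegral_mono_on (integrableOn_ball (by fun_prop) _ _)
      (integrableOn_ball (by fun_prop) _ _) measurableSet_ball fun y _ => hpt y
  rw [integral_add (integrableOn_ball (by fun_prop) _ _) (integrableOn_ball (by fun_prop) _ _),
    setIntegral_const, volume_real_ball_prod hR, integral_const_mul, smul_eq_mul] at hle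
  have hAr := rpow_pos_of_pos hA r
  have h3 := mul_le_mul_of_nonneg_left hL (by positivity : 0 ≤ A / A ^ r)
  rw [mul_rpow hA.le (exp_pos _).le, ← Real.exp_mul] at h3
  have h4 : A / A ^ r * (A ^ r * Real.exp (-1 * r)) = A * Real.exp (-r) := by
    field_simp
  linarith

theorem fderiv_periodic {E F : Type*} [NormedAddCommGroup E] [NormedSpace ℝ E]
    [NormedAddCommGroup F] [NormedSpace ℝ F] {f : E → F} {a : E} (hf : ∀ p, f (p + a) = f p)
    (p : E) : fderiv ℝ f (p + a) = fderiv ℝ f p := by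
  rw [← fderiv_comp_add_right]
  simp only [hf]

theorem abs_le_of_Lnorm_le {h K : ℝ} (hh : 0 < h) (hK : 1 ≤ K) {v : ℝ × ℝ × ℝ → ℝ}
    (hv : ContDiff ℝ 2 v)
    (h1 : ∀ x y z : ℝ, v (x + 1, y, z) = v (x, y, z))
    (h2 : ∀ x y z : ℝ, v (x, y + 1, z) = v (x, y, z))
    (h3 : ∀ x y z : ℝ, v (x, y, z + 2 * h) = v (x, y, z))
    {ρ r S : ℝ} (hρ : 0 < ρ) (hρ1 : ρ ≤ 1 / 4) (hρh : ρ ≤ h / 2) (hr : 2 ≤ r)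
    (hrρ : Real.exp (-r) ≤ 8 * ρ ^ 3)
    (hL : Lnorm h r v / √r ≤ K) (hS0 : 0 ≤ S) (hSρ : ρ * (1 + S) ≤ 1 / 4)
    (hS : ∫ p in Omg h, ‖fderiv ℝ (fderiv ℝ v) p‖ ^ 2 ≤ S) (x₀ : ℝ × ℝ × ℝ) :
    |v x₀| ≤ 6 * Real.exp 1 * K * √r + 1 := by
  have hv0 : Continuous v := hv.continuous
  have hD2 := continuous_norm_fderiv_fderiv hv
  have hr0 : 0 < r := by linarith
  have hsr : 0 < √r := Real.sqrt_pos.2 hr0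
  have hsum : ∀ (a : ℝ × ℝ × ℝ), (∀ p, v (p + a) = v p) → ∀ p,
      ‖fderiv ℝ (fderiv ℝ v) (p + a)‖ ^ 2 = ‖fderiv ℝ (fderiv ℝ v) p‖ ^ 2 := fun a ha p => by
    rw [fderiv_periodic (fderiv_periodic ha)]
  have hD : ∀ R ≤ 2 * ρ,
      ∫ y in Metric.ball 0 R, ‖fderiv ℝ (fderiv ℝ v) (x₀ + y)‖ ^ 2 ≤ S := fun R hR => by
    refine (setIntegral_ball_le_Omg hh (F := fun p => ‖fderiv ℝ (fderiv ℝ v) p‖ ^ 2)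
      (by fun_prop) (fun p => by positivity) ?_ ?_ ?_ x₀ (by linarith) (by linarith)).trans hS
    · intro x y z
      simpa using hsum (1, 0, 0) (fun ⟨x, y, z⟩ => by simpa using h1 x y z) (x, y, z)
    · intro x y z
      simpa using hsum (0, 1, 0) (fun ⟨x, y, z⟩ => by simpa using h2 x y z) (x, y, z)
    · intro x y z
      simpa using hsum (0, 0, 2 * h) (fun ⟨x, y, z⟩ => by simpa using h3 x y z) (x, y, z)
  have hLr : ∫ p in Omg h, |v p| ^ r ≤ (K * √r) ^ r := by
    rw [div_le_iff₀ hsr, Lnorm] at hL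
    have hI : 0 ≤ ∫ p in Omg h, |v p| ^ r := integral_nonneg fun p => by positivity
    have := rpow_le_rpow (by positivity) hL hr0.le
    rwa [← rpow_mul hI, one_div_mul_cancel hr0.ne', rpow_one] at this
  set A : ℝ := K * √r * Real.exp 1 with hA
  have hA0 : 0 < A := by positivity
  have hAe : A * Real.exp (-1) = K * √r := by
    rw [hA, mul_assoc, ← Real.exp_add]; simp
  have hball : ∀ R, 0 ≤ R → R ≤ 2 * ρ →
      ∫ y in Metric.ball 0 R, |v (x₀ + y)| ≤ A * (8 * R ^ 3 + Real.exp (-r)) := fun R hR0 hR => by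
    refine setIntegral_ball_abs_le (by fun_prop) hR0 (by linarith) hA0 ?_
    rw [hAe]
    exact (setIntegral_ball_le_Omg hh (F := fun p => |v p| ^ r)
      (hv0.abs.rpow_const fun _ => Or.inr hr0.le) (fun p => by positivity)
      (fun x y z => by simp only [h1]) (fun x y z => by simp only [h2])
      (fun x y z => by simp only [h3]) x₀ (by linarith) (by linarith)).trans hLr
  have hmain := abs_mul_volume_le hv hD2 (fun _ => le_rfl) x₀ (μ := (1 + S) / ρ) hρ (by positivity) hD
  have hb1 := hball ρ hρ.le (by linarith)
  have hb2 := hball (2 * ρ) (by linarith) le_rfl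
  have hAe' := mul_le_mul_of_nonneg_left hrρ hA0.le
  have hs2 : √2 ≤ 3 / 2 := by
    rw [Real.sqrt_le_left (by norm_num)]; norm_num
  have hrem : (4 * ρ ^ 3 * ((1 + S) / ρ) + S / (2 * ((1 + S) / ρ))) * (2 * √2) ≤ 8 * ρ := by
    have e1 : 4 * ρ ^ 3 * ((1 + S) / ρ) = 4 * ρ * (ρ * (1 + S)) := by field_simp
    have e2 : S / (2 * ((1 + S) / ρ)) = ρ / 2 * (S / (1 + S)) := by field_simp
    have e3 : S / (1 + S) ≤ 1 := (div_le_one (by linarith)).2 (by linarith)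
    have e4 : 4 * ρ ^ 3 * ((1 + S) / ρ) + S / (2 * ((1 + S) / ρ)) ≤ 2 * ρ := by
      rw [e1, e2]; nlinarith
    calc _ ≤ (2 * ρ) * (2 * √2) := mul_le_mul_of_nonneg_right e4 (by positivity)
      _ ≤ 8 * ρ := by nlinarith
  have hX := mul_le_mul_of_nonneg_left hrem (sq_nonneg ρ)
  have hρ3 : 0 < ρ ^ 3 := by positivity
  have hAρ : 0 < A * ρ ^ 3 := by positivity
  have hfin : 8 * ρ ^ 3 * |v x₀| ≤ 8 * ρ ^ 3 * (6 * A + 1) := by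
    nlinarith
  have := le_of_mul_le_mul_left hfin (by positivity)
  calc |v x₀| ≤ 6 * A + 1 := this
    _ = _ := by rw [hA]; ring

/-- If all `L^r` norms of `v` grow at most like `√r`, then `‖v‖_∞²` is controlled by
the logarithm of `‖v‖_{H²}²` (log-Sobolev with `λ = 1/2` plus `H² ↪ W^{1,6}`). -/
theorem stmt_19 (h K : ℝ) (hh : 0 < h) (hK : 1 ≤ K) :
    ∃ C > 0, ∀ v : ℝ × ℝ × ℝ → ℝ,
      ContDiff ℝ 2 v →
      (∀ x y z : ℝ, v (x + 1, y, z) = v (x, y, z)) →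
      (∀ x y z : ℝ, v (x, y + 1, z) = v (x, y, z)) →
      (∀ x y z : ℝ, v (x, y, z + 2 * h) = v (x, y, z)) →
      IntegrableOn (fun p => (v p) ^ 2 + ‖fderiv ℝ v p‖ ^ 2 + ‖fderiv ℝ (fderiv ℝ v) p‖ ^ 2)
        (Omg h) volume →
      IntegrableOn (fun p => |v p| ^ (6 : ℝ) + ‖fderiv ℝ v p‖ ^ (6 : ℝ)) (Omg h) volume →
      (∀ r : ℝ, 2 ≤ r → Lnorm h r v / Real.sqrt r ≤ K) →
      (eLpNorm v ⊤ (volume.restrict (Omg h))).toReal ^ 2 ≤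
        C * Real.log (C * H2sq h v + Real.exp 1) := by
  set c : ℝ := min (1 / 4) (h / 2) with hc
  have hc0 : 0 < c := lt_min (by norm_num) (by linarith)
  have hc1 : c ≤ 1 / 4 := min_le_left _ _
  have hlc : 0 ≤ Real.log c⁻¹ := Real.log_nonneg ((one_le_inv₀ hc0).2 (by linarith))
  set N : ℝ := 74 * Real.exp 1 ^ 2 * K ^ 2 * (5 + 3 * Real.log c⁻¹) with hN
  have he1 : 1 ≤ Real.exp 1 := Real.one_le_exp zero_le_one
  have hN1 : 1 ≤ N := by
    have h1 : 1 ≤ Real.exp 1 ^ 2 := one_le_pow₀ he1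
    have h2 : 1 ≤ K ^ 2 := one_le_pow₀ hK
    have h3 : 1 ≤ Real.exp 1 ^ 2 * K ^ 2 := one_le_mul_of_one_le_of_one_le h1 h2
    rw [hN]
    nlinarith
  refine ⟨N, by linarith, fun v hv h1 h2 h3 hint _ hL => ?_⟩
  set S : ℝ := H2sq h v with hSdef
  have hS0 : 0 ≤ S := integral_nonneg fun p => by positivity
  have hS : ∫ p in Omg h, ‖fderiv ℝ (fderiv ℝ v) p‖ ^ 2 ≤ S :=
    integral_mono_of_nonneg (Filter.Eventually.of_forall fun p => by positivity) hint
      (Filter.Eventually.of_forall fun p => by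
        simp only
        linarith [sq_nonneg (v p), sq_nonneg ‖fderiv ℝ v p‖])
  set ρ : ℝ := c / (1 + S) with hρ
  have hρ0 : 0 < ρ := by positivity
  have hρS : ρ * (1 + S) = c := by rw [hρ]; field_simp
  have hρc : ρ ≤ c := div_le_self hc0.le (by linarith)
  have hlρ : 0 ≤ -Real.log ρ := by
    linarith [Real.log_nonpos hρ0.le (by linarith)]
  set r : ℝ := 2 + 3 * -Real.log ρ with hr
  have hr2 : 2 ≤ r := by linarith
  have hrρ : Real.exp (-r) ≤ 8 * ρ ^ 3 := by
    have : Real.exp (-r) = Real.exp (-2) * ρ ^ 3 := by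
      rw [hr, show -(2 + 3 * -Real.log ρ) = -2 + (3 : ℕ) * Real.log ρ by push_cast; ring,
        Real.exp_add, Real.exp_nat_mul, Real.exp_log hρ0]
    rw [this]
    have : Real.exp (-2) ≤ 1 := Real.exp_le_one_iff.2 (by norm_num)
    have : 0 < ρ ^ 3 := by positivity
    nlinarith
  set M : ℝ := 6 * Real.exp 1 * K * √r + 1 with hM
  have hM0 : 0 ≤ M := by positivity
  have hbound : ∀ x, |v x| ≤ M := fun x =>
    abs_le_of_Lnorm_le hh hK hv h1 h2 h3 hρ0 (by linarith)
      (hρc.trans (min_le_right _ _)) hr2 hrρ (hL r hr2) hS0 (by linarith) hS x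
  have hsup : (eLpNorm v ⊤ (volume.restrict (Omg h))).toReal ≤ M := by
    rw [eLpNorm_exponent_top]
    exact ENNReal.toReal_le_of_le_ofReal hM0
      (eLpNormEssSup_le_of_ae_bound (Filter.Eventually.of_forall hbound))
  have hM2 : M ^ 2 ≤ 74 * Real.exp 1 ^ 2 * K ^ 2 * r := by
    have e : (6 * Real.exp 1 * K * √r) ^ 2 = 36 * (Real.exp 1 ^ 2 * K ^ 2) * r := by
      rw [mul_pow, Real.sq_sqrt (by linarith)]; ring
    have h3 : 1 ≤ Real.exp 1 ^ 2 * K ^ 2 :=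
      one_le_mul_of_one_le_of_one_le (one_le_pow₀ he1) (one_le_pow₀ hK)
    have := sq_nonneg (6 * Real.exp 1 * K * √r - 1)
    rw [hM]
    nlinarith
  have hNS : S ≤ N * S := le_mul_of_one_le_left hS0 hN1
  set L : ℝ := Real.log (N * S + Real.exp 1) with hLdef
  have hL1 : 1 ≤ L := by
    rw [hLdef, Real.le_log_iff_exp_le (by positivity)]
    linarith
  have hlog : -Real.log ρ ≤ L + Real.log c⁻¹ := by
    rw [hρ, Real.log_div hc0.ne' (by positivity), Real.log_inv]
    have : Real.log (1 + S) ≤ L := Real.log_le_log (by positivity) (by linarith)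
    linarith
  have hrL : r ≤ (5 + 3 * Real.log c⁻¹) * L := by nlinarith
  calc _ ≤ M ^ 2 := pow_le_pow_left₀ ENNReal.toReal_nonneg hsup 2
    _ ≤ 74 * Real.exp 1 ^ 2 * K ^ 2 * r := hM2
    _ ≤ 74 * Real.exp 1 ^ 2 * K ^ 2 * ((5 + 3 * Real.log c⁻¹) * L) := by gcongr
    _ = N * L := by rw [hN]; ring
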